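/- Let φ : V → W be a linear map between finite-dimensional real vector spaces and L ⊆ V ⊕ V* a maximally isotropic subspace. Then the forward image F_φ(L) = {(φ(X), α) : X ∈ V, α ∈ W*, (X, φ*α) ∈ L} is a maximally isotropic subspace of W ⊕ W*. -/

import Mathlib

open Module

variable {V : Type*} [AddCommGroup V] [Module ℝ V] [FiniteDimensional ℝ V]
variable {W : Type*} [AddCommGroup W] [Module ℝ W] [FiniteDimensional ℝ W]

/-- The canonical symmetric pairing on `V ⊕ V*`:
`⟨(X,α),(Y,β)⟩₊ = (β(X) + α(Y))/2`. -/
noncomputable def pairPlus {V : Type*} [AddCommGroup V] [Module ℝ V]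
    (p q : V × Module.Dual ℝ V) : ℝ := (q.2 p.1 + p.2 q.1) / 2

/-- A subspace of `V ⊕ V*` is isotropic if the pairing vanishes identically on it. -/
def IsIsotropic {V : Type*} [AddCommGroup V] [Module ℝ V]
    (L : Submodule ℝ (V × Module.Dual ℝ V)) : Prop :=
  ∀ p ∈ L, ∀ q ∈ L, pairPlus p q = 0

/-- Maximally isotropic: isotropic and of dimension `dim V`. -/
def IsMaxIsotropic {V : Type*} [AddCommGroup V] [Module ℝ V]
    (L : Submodule ℝ (V × Module.Dual ℝ V)) : Prop :=
  IsIsotropic L ∧ Module.finrank ℝ L = Module.finrank ℝ V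

/-- Backward image of `K ⊆ W ⊕ W*` under `φ : V → W`:
`B_φ(K) = {(X, φ*α) : (φ X, α) ∈ K}`. -/
def bimg {V W : Type*} [AddCommGroup V] [Module ℝ V] [AddCommGroup W] [Module ℝ W]
    (φ : V →ₗ[ℝ] W) (K : Submodule ℝ (W × Module.Dual ℝ W)) :
    Submodule ℝ (V × Module.Dual ℝ V) :=
  (K.comap (LinearMap.prodMap φ (LinearMap.id))).map
    (LinearMap.prodMap LinearMap.id φ.dualMap)

/-- Forward image of `L ⊆ V ⊕ V*` under `φ : V → W`:
`F_φ(L) = {(φ X, α) : (X, φ*α) ∈ L}`. -/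
def fimg {V W : Type*} [AddCommGroup V] [Module ℝ V] [AddCommGroup W] [Module ℝ W]
    (φ : V →ₗ[ℝ] W) (L : Submodule ℝ (V × Module.Dual ℝ V)) :
    Submodule ℝ (W × Module.Dual ℝ W) :=
  (L.comap (LinearMap.prodMap LinearMap.id φ.dualMap)).map
    (LinearMap.prodMap φ LinearMap.id)


/-- Rank–nullity for the restriction of a linear map to a subspace. -/
theorem finrank_map_add_finrank_inf_ker {K E F : Type*} [Field K] [AddCommGroup E] [Module K E]
    [FiniteDimensional K E] [AddCommGroup F] [Module K F] (f : E →ₗ[K] F) (p : Submodule K E) :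
    finrank K (p.map f) + finrank K (p ⊓ LinearMap.ker f : Submodule K E) = finrank K p := by
  have h := (f.domRestrict p).finrank_range_add_finrank_ker
  rw [LinearMap.range_domRestrict, LinearMap.ker_domRestrict] at h
  rw [← h, ← Submodule.map_comap_subtype, Submodule.finrank_map_subtype_eq]

/-- The symmetric bilinear form `((X, α), (Y, β)) ↦ β X + α Y` on `V ⊕ V*`. -/
def pairForm (V : Type*) [AddCommGroup V] [Module ℝ V] :
    LinearMap.BilinForm ℝ (V × Module.Dual ℝ V) :=
  (LinearMap.dualProd ℝ V).compl₁₂ (LinearEquiv.prodComm ℝ V (Module.Dual ℝ V)).toLinearMap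
    (LinearEquiv.prodComm ℝ V (Module.Dual ℝ V)).toLinearMap

theorem pairForm_apply {V : Type*} [AddCommGroup V] [Module ℝ V] (p q : V × Module.Dual ℝ V) :
    pairForm V p q = q.2 p.1 + p.2 q.1 := by
  simp [pairForm]

theorem pairForm_isSymm (V : Type*) [AddCommGroup V] [Module ℝ V] : (pairForm V).IsSymm :=
  ⟨fun p q => by simp [pairForm_apply, add_comm]⟩

theorem pairForm_nondegenerate (V : Type*) [AddCommGroup V] [Module ℝ V] :
    (pairForm V).Nondegenerate := by
  refine (pairForm_isSymm V).isRefl.nondegenerate_iff_separatingLeft.2 ?_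
  rintro ⟨X, α⟩ h
  refine Prod.ext ((Module.forall_dual_apply_eq_zero_iff ℝ X).1 fun β => ?_)
    (LinearMap.ext fun Y => ?_)
  · simpa [pairForm_apply] using h (0, β)
  · simpa [pairForm_apply] using h (Y, 0)

theorem isIsotropic_iff_le_orthogonal {V : Type*} [AddCommGroup V] [Module ℝ V]
    {L : Submodule ℝ (V × Module.Dual ℝ V)} :
    IsIsotropic L ↔ L ≤ (pairForm V).orthogonal L := by
  have h (p q : V × Module.Dual ℝ V) : pairPlus p q = 0 ↔ pairForm V p q = 0 := by
    simp [pairPlus, pairForm_apply]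
  simp only [IsIsotropic, h]
  exact ⟨fun H q hq p hp => H p hp q hq, fun H p hp q hq => H hq p hp⟩

theorem finrank_orthogonal_pairForm (L : Submodule ℝ (V × Module.Dual ℝ V)) :
    finrank ℝ L + finrank ℝ ((pairForm V).orthogonal L) = 2 * finrank ℝ V := by
  have h := LinearMap.BilinForm.finrank_orthogonal (pairForm_nondegenerate V) L
  have hle := L.finrank_le
  have hd : finrank ℝ (V × Module.Dual ℝ V) = 2 * finrank ℝ V := by
    rw [finrank_prod, Subspace.dual_finrank_eq, two_mul]
  lia

/-- A maximally isotropic subspace is its own orthogonal. -/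
theorem IsMaxIsotropic.orthogonal_eq {L : Submodule ℝ (V × Module.Dual ℝ V)}
    (hL : IsMaxIsotropic L) : (pairForm V).orthogonal L = L := by
  have h := finrank_orthogonal_pairForm L
  have hd := hL.2
  exact (Submodule.eq_of_le_of_finrank_eq (isIsotropic_iff_le_orthogonal.1 hL.1) (by lia)).symm

/-- For `L` maximally isotropic, `dim (L ∩ C^⊥) + dim C = dim V + dim (L ∩ C)`. -/
theorem IsMaxIsotropic.finrank_inf_orthogonal {L : Submodule ℝ (V × Module.Dual ℝ V)}
    (hL : IsMaxIsotropic L) (C : Submodule ℝ (V × Module.Dual ℝ V)) :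
    finrank ℝ (L ⊓ (pairForm V).orthogonal C : Submodule ℝ (V × Module.Dual ℝ V)) +
        finrank ℝ C =
      finrank ℝ V + finrank ℝ (L ⊓ C : Submodule ℝ (V × Module.Dual ℝ V)) := by
  have hsup : (pairForm V).orthogonal (L ⊔ C) = L ⊓ (pairForm V).orthogonal C := by
    refine le_antisymm (le_inf ?_ (LinearMap.BilinForm.orthogonal_le le_sup_right)) ?_
    · exact (LinearMap.BilinForm.orthogonal_le le_sup_left).trans hL.orthogonal_eq.le
    · rintro q ⟨hq, hqC⟩ p hp
      obtain ⟨a, ha, c, hc, rfl⟩ := Submodule.mem_sup.1 hp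
      have h₁ : pairForm V a q = 0 := hL.orthogonal_eq.ge hq a ha
      have h₂ : pairForm V c q = 0 := hqC c hc
      change pairForm V (a + c) q = 0
      rw [map_add, LinearMap.add_apply, h₁, h₂, add_zero]
  have h := finrank_orthogonal_pairForm (L ⊔ C)
  have hmod := Submodule.finrank_sup_add_finrank_inf_eq L C
  have hd := hL.2
  rw [hsup] at h
  lia

theorem IsIsotropic.fimg {V W : Type*} [AddCommGroup V] [Module ℝ V] [AddCommGroup W] [Module ℝ W]
    (φ : V →ₗ[ℝ] W) {L : Submodule ℝ (V × Module.Dual ℝ V)} (hL : IsIsotropic L) :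
    IsIsotropic (fimg φ L) := by
  rintro _ ⟨p, hp, rfl⟩ _ ⟨q, hq, rfl⟩
  exact hL _ hp _ hq

/-- The range of `id × φ*` is the orthogonal of `ker φ × 0`. -/
theorem range_prodMap_dualMap_eq_orthogonal {V W : Type*} [AddCommGroup V] [Module ℝ V]
    [AddCommGroup W] [Module ℝ W] (φ : V →ₗ[ℝ] W) :
    LinearMap.range (LinearMap.prodMap (LinearMap.id : V →ₗ[ℝ] V) φ.dualMap) =
      (pairForm V).orthogonal ((LinearMap.ker φ).prod ⊥) := by
  rw [LinearMap.range_prodMap, LinearMap.range_id, φ.range_dualMap_eq_dualAnnihilator_ker]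
  ext ⟨X, α⟩
  simp [Submodule.mem_dualAnnihilator, LinearMap.BilinForm.mem_orthogonal_iff,
    pairForm_apply]

/-- the forward image of a maximally isotropic subspace is
maximally isotropic. -/
theorem fimg_maxIsotropic (φ : V →ₗ[ℝ] W) (L : Submodule ℝ (V × Module.Dual ℝ V))
    (hL : IsMaxIsotropic L) : IsMaxIsotropic (fimg φ L) := by
  refine ⟨hL.1.fimg φ, ?_⟩
  set g := LinearMap.prodMap (LinearMap.id : V →ₗ[ℝ] V) φ.dualMap with hg
  set f := LinearMap.prodMap φ (LinearMap.id : Module.Dual ℝ W →ₗ[ℝ] Module.Dual ℝ W) with hf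
  have hmap_f := finrank_map_add_finrank_inf_ker f (L.comap g)
  have hmap_g := finrank_map_add_finrank_inf_ker g (L.comap g)
  have hker_inf : finrank ℝ (L.comap g ⊓ LinearMap.ker f : Submodule ℝ (V × Module.Dual ℝ W)) =
      finrank ℝ (L ⊓ (LinearMap.ker φ).prod ⊥ : Submodule ℝ (V × Module.Dual ℝ V)) := by
    have h := finrank_map_add_finrank_inf_ker g (L.comap g ⊓ LinearMap.ker f)
    have hbot : L.comap g ⊓ LinearMap.ker f ⊓ LinearMap.ker g = ⊥ := by
      rw [eq_bot_iff]
      rintro ⟨X, α⟩ ⟨⟨-, hXf⟩, hXg⟩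
      simp_all
    have himg : (L.comap g ⊓ LinearMap.ker f).map g = L ⊓ (LinearMap.ker φ).prod ⊥ := by
      ext ⟨X, α⟩
      constructor
      · rintro ⟨⟨Y, β⟩, ⟨hL, hY⟩, h⟩
        simp_all
      · rintro ⟨hL, hX, hα⟩
        exact ⟨(X, 0), by simp_all, by simp_all⟩
    rw [hbot, himg, finrank_bot, add_zero] at h
    exact h.symm
  have hker_g : L.comap g ⊓ LinearMap.ker g = LinearMap.ker g :=
    inf_eq_right.2 (LinearMap.ker_le_comap g)
  have hrange : LinearMap.range g = (pairForm V).orthogonal ((LinearMap.ker φ).prod ⊥) :=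
    range_prodMap_dualMap_eq_orthogonal φ
  rw [Submodule.map_comap_eq, hker_g, inf_comm, hrange] at hmap_g
  have hrank := g.finrank_range_add_finrank_ker
  rw [hrange, finrank_prod, Subspace.dual_finrank_eq] at hrank
  have hC := finrank_orthogonal_pairForm
    ((LinearMap.ker φ).prod (⊥ : Submodule ℝ (Module.Dual ℝ V)))
  have hinf := hL.finrank_inf_orthogonal ((LinearMap.ker φ).prod ⊥)
  change finrank ℝ ((L.comap g).map f) = finrank ℝ W
  lia
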